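/- Let μ be a nonnegative Radon measure on ℝⁿ, p₁,…,p_m ∈ (1,∞), 1/p = 1/p₁+⋯+1/p_m, 0 < p ≤ p₀ < n/α, and 0 < α < mn. Then for all f⃗ = (f₁,…,f_m), ‖M_α^D(f⃗)‖_{M_μ^{p,p₀}} ≲ ‖μ‖_{n−αp}^{1/p} ‖f⃗‖_{M^{P⃗,p₀}}, with implicit constant independent of μ and f⃗. -/

import Mathlib

open MeasureTheory ENNReal

noncomputable section

variable {n : ℕ}

/-- Axis-parallel cube with lower corner `a` and side length `r` (half-open). -/
def cube (a : Fin n → ℝ) (r : ℝ) : Set (Fin n → ℝ) :=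
  {y | ∀ i, a i ≤ y i ∧ y i < a i + r}

/-- The dyadic cube `2^{-k}(m + [0,1)^n)`. -/
def dyadicCube (k : ℤ) (mv : Fin n → ℤ) : Set (Fin n → ℝ) :=
  cube (fun i => (mv i : ℝ) * (2 : ℝ) ^ (-k)) ((2 : ℝ) ^ (-k))

/-- The concentric triple `3Q` of the cube with corner `a` and side `r`. -/
def tripleCube (a : Fin n → ℝ) (r : ℝ) : Set (Fin n → ℝ) :=
  cube (fun i => a i - r) (3 * r)

/-- The Morrey norm `‖f‖_{M^{p,p₀}}`. -/
def morreyNorm (p p0 : ℝ) (f : (Fin n → ℝ) → ℝ) : ℝ≥0∞ :=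
  ⨆ (a : Fin n → ℝ) (r : ℝ) (_ : 0 < r),
    volume (cube a r) ^ (1 / p0 - 1 / p) *
      (∫⁻ x in cube a r, ENNReal.ofReal |f x| ^ p) ^ (1 / p)

/-- The product Morrey norm `‖f⃗‖_{M^{P⃗,p₀}}`. -/
def prodMorreyNorm {m : ℕ} (P : Fin m → ℝ) (p p0 : ℝ)
    (f : Fin m → (Fin n → ℝ) → ℝ) : ℝ≥0∞ :=
  ⨆ (a : Fin n → ℝ) (r : ℝ) (_ : 0 < r),
    volume (cube a r) ^ (1 / p0 - 1 / p) *
      ∏ j, (∫⁻ x in cube a r, ENNReal.ofReal |f j x| ^ P j) ^ (1 / P j)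

/-- The Radon–Morrey norm `‖g‖_{M_μ^{q,q₀}}`. -/
def radonMorreyNorm (μ : Measure (Fin n → ℝ)) (q q0 : ℝ)
    (g : (Fin n → ℝ) → ℝ≥0∞) : ℝ≥0∞ :=
  ⨆ (a : Fin n → ℝ) (r : ℝ) (_ : 0 < r),
    volume (cube a r) ^ (1 / q0 - 1 / q) * (∫⁻ x in cube a r, g x ^ q ∂μ) ^ (1 / q)

/-- The growth norm `‖μ‖_β := sup_Q μ(Q)/ℓ_Q^β`. -/
def measureGrowthNorm (μ : Measure (Fin n → ℝ)) (β : ℝ) : ℝ≥0∞ :=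
  ⨆ (a : Fin n → ℝ) (r : ℝ) (_ : 0 < r), μ (cube a r) / ENNReal.ofReal r ^ β

/-- The `m`-sublinear fractional maximal operator `𝔐_α`. -/
def fracMaximal {m : ℕ} (α : ℝ) (f : Fin m → (Fin n → ℝ) → ℝ)
    (x : Fin n → ℝ) : ℝ≥0∞ :=
  ⨆ (a : Fin n → ℝ) (r : ℝ) (_ : 0 < r) (_ : x ∈ cube a r),
    ENNReal.ofReal r ^ (α - (m : ℝ) * n) *
      ∏ j, ∫⁻ y in cube a r, ENNReal.ofReal |f j y|

/-- The dyadic `m`-sublinear fractional maximal operator `𝔐_α^𝒟`. -/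
def dyadicFracMaximal {m : ℕ} (α : ℝ) (f : Fin m → (Fin n → ℝ) → ℝ)
    (x : Fin n → ℝ) : ℝ≥0∞ :=
  ⨆ (k : ℤ) (mv : Fin n → ℤ) (_ : x ∈ dyadicCube k mv),
    ENNReal.ofReal ((2 : ℝ) ^ (-k)) ^ (α - (m : ℝ) * n) *
      ∏ j, ∫⁻ y in dyadicCube k mv, ENNReal.ofReal |f j y|

/-- The dyadic `m`-linear fractional integral operator `ℑ_α^𝒟`. -/
def dyadicFracIntegral {m : ℕ} (α : ℝ) (f : Fin m → (Fin n → ℝ) → ℝ)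
    (x : Fin n → ℝ) : ℝ≥0∞ :=
  ∑' qk : ℤ × (Fin n → ℤ),
    (dyadicCube qk.1 qk.2).indicator
      (fun _ => ENNReal.ofReal ((2 : ℝ) ^ (-qk.1)) ^ (α - (m : ℝ) * n) *
        ∏ j, ∫⁻ y in dyadicCube qk.1 qk.2, ENNReal.ofReal |f j y|) x

/-- The `m`-linear fractional integral operator `ℑ_α` (with Euclidean distances). -/
def fracIntegral {m : ℕ} (α : ℝ) (f : Fin m → (Fin n → ℝ) → ℝ)
    (x : Fin n → ℝ) : ℝ≥0∞ :=
  ∫⁻ y : Fin m → Fin n → ℝ,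
    (∏ j, ENNReal.ofReal |f j (y j)|) /
      ENNReal.ofReal ((∑ j, Real.sqrt (∑ i, (x i - y j i) ^ 2)) ^ ((m : ℝ) * n - α))



/-! ### Dyadic index -/

def idx (k : ℤ) (x : Fin n → ℝ) : Fin n → ℤ := fun i => ⌊x i * (2 : ℝ) ^ k⌋

lemma mem_dyadicCube_iff (k : ℤ) (mv : Fin n → ℤ) (x : Fin n → ℝ) :
    x ∈ dyadicCube k mv ↔ idx k x = mv := by
  have h2 : (0 : ℝ) < (2 : ℝ) ^ k := by positivity
  simp only [dyadicCube, cube, Set.mem_ofPred_eq, funext_iff, idx, Int.floor_eq_iff, zpow_neg]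
  refine forall_congr' fun i => ?_
  rw [← div_eq_mul_inv, div_le_iff₀ h2, ← one_div, ← add_div, lt_div_iff₀ h2]

lemma idx_succ (k : ℤ) (x : Fin n → ℝ) (i : Fin n) : idx (k + 1) x i / 2 = idx k x i := by
  unfold idx
  rw [zpow_add_one₀ (by norm_num : (2 : ℝ) ≠ 0)]
  rw [← mul_assoc]
  have h : ⌊x i * 2 ^ k * 2⌋ / 2 = ⌊x i * (2:ℝ) ^ k⌋ := by
    generalize x i * (2:ℝ) ^ k = y
    have h1 := Int.floor_le y
    have h2 := Int.lt_floor_add_one y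
    have h3 : 2 * ⌊y⌋ ≤ ⌊y * 2⌋ := by
      rw [Int.le_floor]; push_cast; linarith
    have h4 : ⌊y * 2⌋ < 2 * ⌊y⌋ + 2 := by
      rw [Int.floor_lt]; push_cast; linarith
    omega
  exact h

lemma measurableSet_cube (a : Fin n → ℝ) (r : ℝ) : MeasurableSet (cube a r) := by
  have : cube a r = Set.univ.pi fun i => Set.Ico (a i) (a i + r) := by
    ext y; simp [cube, Set.mem_pi]
  rw [this]
  exact MeasurableSet.univ_pi fun i => measurableSet_Ico

lemma volume_cube (a : Fin n → ℝ) (r : ℝ) : volume (cube a r) = ENNReal.ofReal r ^ n := by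
  have : cube a r = Set.univ.pi fun i => Set.Ico (a i) (a i + r) := by
    ext y; simp [cube, Set.mem_pi]
  rw [this, volume_pi_pi]
  simp

lemma measurableSet_dy (k : ℤ) (mv : Fin n → ℤ) : MeasurableSet (dyadicCube k mv) :=
  measurableSet_cube _ _

lemma measurable_idx (k : ℤ) : Measurable (idx k : (Fin n → ℝ) → (Fin n → ℤ)) := by
  apply measurable_to_countable'
  intro mv
  convert measurableSet_dy k mv using 1
  ext x
  simp [mem_dyadicCube_iff]

lemma lintegral_children (μ : Measure (Fin n → ℝ)) (F : (Fin n → ℝ) → ℝ≥0∞) (k : ℤ)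
    (mv : Fin n → ℤ) :
    ∫⁻ x in dyadicCube k mv, F x ∂μ =
      ∑' j : {j : Fin n → ℤ // ∀ i, j i / 2 = mv i}, ∫⁻ x in dyadicCube (k + 1) j.1, F x ∂μ := by
  have hU : dyadicCube k mv =
      ⋃ j : {j : Fin n → ℤ // ∀ i, j i / 2 = mv i}, dyadicCube (k + 1) j.1 := by
    ext x
    simp only [Set.mem_iUnion, mem_dyadicCube_iff]
    constructor
    · intro h
      exact ⟨⟨idx (k + 1) x, fun i => by rw [idx_succ, h]⟩, rfl⟩
    · rintro ⟨⟨j, hj⟩, h⟩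
      funext i
      rw [← idx_succ, h, hj]
  rw [hU, lintegral_iUnion (fun j => measurableSet_dy _ _)]
  intro j j' hne
  refine Set.disjoint_left.2 fun x hx hx' => hne ?_
  rw [mem_dyadicCube_iff] at hx hx'
  exact Subtype.ext (hx.symm.trans hx')

/-! ### Truncated maximal functions -/

def smax (c : ℤ → (Fin n → ℤ) → ℝ≥0∞) : ℕ → ℤ → (Fin n → ℝ) → ℝ≥0∞
  | 0, _, _ => 0
  | N + 1, k, x => c k (idx k x) ⊔ smax c N (k + 1) x

lemma measurable_smax (c : ℤ → (Fin n → ℤ) → ℝ≥0∞) (N : ℕ) (k : ℤ) :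
    Measurable (smax c N k) := by
  induction N generalizing k with
  | zero => exact measurable_const
  | succ N ih =>
    exact ((measurable_of_countable (c k)).comp (measurable_idx k)).sup (ih (k + 1))

lemma smax_mono (c : ℤ → (Fin n → ℤ) → ℝ≥0∞) (N : ℕ) (k : ℤ) (x : Fin n → ℝ) :
    smax c N k x ≤ smax c (N + 1) k x := by
  induction N generalizing k with
  | zero => exact zero_le
  | succ N ih => exact sup_le_sup le_rfl (ih (k + 1))

lemma le_smax (c : ℤ → (Fin n → ℤ) → ℝ≥0∞) (N : ℕ) (k : ℤ) (x : Fin n → ℝ) :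
    c (k + N) (idx (k + N) x) ≤ smax c (N + 1) k x := by
  induction N generalizing k with
  | zero => simp [smax]
  | succ N ih =>
    have := ih (k + 1)
    rw [show (k + 1 + (N : ℤ)) = k + ((N + 1 : ℕ) : ℤ) by push_cast; ring] at this
    exact this.trans (le_sup_right (a := c k (idx k x)))

lemma smax_le (c : ℤ → (Fin n → ℤ) → ℝ≥0∞) (N : ℕ) (k : ℤ) (x : Fin n → ℝ) (B : ℝ≥0∞)
    (h : ∀ i : ℕ, i < N → c (k + i) (idx (k + i) x) ≤ B) : smax c N k x ≤ B := by
  induction N generalizing k with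
  | zero => exact zero_le
  | succ N ih =>
    refine sup_le (by simpa using h 0 (by omega)) (ih (k + 1) fun i hi => ?_)
    have := h (i + 1) (by omega)
    rwa [show k + ((i + 1 : ℕ) : ℤ) = k + 1 + i by push_cast; ring] at this

lemma le_smax' (c : ℤ → (Fin n → ℤ) → ℝ≥0∞) (N : ℕ) (k : ℤ) (x : Fin n → ℝ) (i : ℕ)
    (hi : i < N) : c (k + i) (idx (k + i) x) ≤ smax c N k x :=
  (le_smax c i k x).trans
    (monotone_nat_of_le_succ (f := fun N => smax c N k x) (fun N => smax_mono c N k x) hi)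

/-- A Carleson embedding proved by induction on the depth. -/
lemma carleson (μ : Measure (Fin n → ℝ)) (w : ℤ → ℝ≥0∞) (hw : Antitone w)
    (d : ℤ → (Fin n → ℤ) → ℝ≥0∞) (G : ℝ≥0∞)
    (hG : ∀ k mv, w k * μ (dyadicCube k mv) ≤ G * volume (dyadicCube k mv))
    (N : ℕ) (k : ℤ) (mv : Fin n → ℤ) (s : ℝ≥0∞) :
    ∫⁻ x in dyadicCube k mv, smax (fun k i => w k * (d k i - s)) N k x ∂μ ≤
      G * ∫⁻ x in dyadicCube k mv, (smax d N k x - s) := by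
  induction N generalizing k mv s with
  | zero => simp [smax]
  | succ N ih =>
    set s' := s ⊔ d k mv with hs'
    have h1 : ∀ x ∈ dyadicCube k mv, smax (fun k i => w k * (d k i - s)) (N + 1) k x ≤
        w k * (s' - s) + smax (fun k i => w k * (d k i - s')) N (k + 1) x := by
      intro x hx
      rw [mem_dyadicCube_iff] at hx
      refine sup_le ?_ ?_
      · refine le_trans ?_ le_self_add
        rw [hx]
        exact mul_le_mul_right (tsub_le_tsub_right le_sup_right _) _
      · refine smax_le _ _ _ _ _ fun i hi => ?_
        refine le_trans ?_ (add_le_add le_rfl (le_smax' _ N _ _ i hi))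
        calc _ ≤ w (k + 1 + i) * ((d (k + 1 + i) (idx (k + 1 + i) x) - s') + (s' - s)) := by
              gcongr; exact tsub_le_tsub_add_tsub
          _ = w (k + 1 + i) * (s' - s) + w (k + 1 + i) *
                (d (k + 1 + i) (idx (k + 1 + i) x) - s') := by ring
          _ ≤ _ := by
              gcongr
              exact hw (by omega)
    have h2 : ∀ x ∈ dyadicCube k mv, (s' - s) + (smax d N (k + 1) x - s') ≤
        smax d (N + 1) k x - s := by
      intro x hx
      rw [mem_dyadicCube_iff] at hx
      have e : smax d (N + 1) k x = d k mv ⊔ smax d N (k + 1) x := by rw [← hx]; rfl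
      rw [e]
      rcases le_total (smax d N (k + 1) x) s' with h | h
      · rw [tsub_eq_zero_of_le h, add_zero, tsub_le_iff_right]
        refine sup_le le_add_self ?_
        exact le_trans le_sup_left le_tsub_add
      · rw [add_comm, tsub_add_tsub_cancel h le_sup_left]
        exact tsub_le_tsub_right le_sup_right _
    calc _ ≤ ∫⁻ x in dyadicCube k mv, (w k * (s' - s) +
              smax (fun k i => w k * (d k i - s')) N (k + 1) x) ∂μ :=
            setLIntegral_mono' (measurableSet_dy _ _) h1
      _ = (s' - s) * (w k * μ (dyadicCube k mv)) + ∫⁻ x in dyadicCube k mv,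
              smax (fun k i => w k * (d k i - s')) N (k + 1) x ∂μ := by
            rw [lintegral_add_left measurable_const, setLIntegral_const]; ring
      _ ≤ (s' - s) * (G * volume (dyadicCube k mv)) +
            G * ∫⁻ x in dyadicCube k mv, (smax d N (k + 1) x - s') := by
            refine add_le_add (mul_le_mul_right (hG k mv) _) ?_
            · rw [lintegral_children, lintegral_children, ← ENNReal.tsum_mul_left]
              exact ENNReal.tsum_le_tsum fun j => ih _ _ _
      _ = G * ∫⁻ x in dyadicCube k mv, ((s' - s) + (smax d N (k + 1) x - s')) := by
            rw [lintegral_add_left measurable_const, setLIntegral_const]; ring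
      _ ≤ _ := by
            refine mul_le_mul_right ?_ _
            exact setLIntegral_mono' (measurableSet_dy _ _) h2

def avg (F : (Fin n → ℝ) → ℝ≥0∞) (k : ℤ) (mv : Fin n → ℤ) : ℝ≥0∞ :=
  (∫⁻ x in dyadicCube k mv, F x) / volume (dyadicCube k mv)

lemma vol_dy (k : ℤ) (mv : Fin n → ℤ) :
    volume (dyadicCube k mv) = ENNReal.ofReal ((2 : ℝ) ^ (-k)) ^ n := volume_cube _ _

lemma L_ne_zero (k : ℤ) : ENNReal.ofReal ((2 : ℝ) ^ (-k)) ≠ 0 := by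
  rw [Ne, ENNReal.ofReal_eq_zero, not_le]; positivity

lemma vol_ne_zero (k : ℤ) (mv : Fin n → ℤ) : volume (dyadicCube k mv) ≠ 0 := by
  rw [vol_dy]; exact pow_ne_zero _ (L_ne_zero k)

lemma vol_ne_top (k : ℤ) (mv : Fin n → ℤ) : volume (dyadicCube k mv) ≠ ∞ := by
  rw [vol_dy]; exact ENNReal.pow_ne_top ENNReal.ofReal_ne_top

lemma young_aux (q : ℝ) (hq : 1 < q) (s t : ℝ≥0∞) (hs : s ≠ ∞) (ht : t ≠ ∞) :
    t ^ q + ENNReal.ofReal (q / (q - 1)) * s ^ (q - 1) * t ≤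
      ENNReal.ofReal (q / (q - 1)) * t ^ (q - 1) * t + s ^ q := by
  lift s to NNReal using hs
  lift t to NNReal using ht
  have hq1 : 0 < q - 1 := by linarith
  have hK : 0 ≤ q / (q - 1) := by positivity
  have hc : Real.HolderConjugate (q / (q - 1)) q := by
    have := (Real.HolderConjugate.conjExponent hq).symm
    simpa [Real.conjExponent] using this
  have hy := Real.young_inequality_of_nonneg (a := (s : ℝ) ^ (q - 1)) (b := t)
    (by positivity) (by positivity) hc
  rw [← Real.rpow_mul (NNReal.coe_nonneg s), show (q - 1) * (q / (q - 1)) = q by field_simp] at hy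
  have ht1 : (t : ℝ) ^ (q - 1) * t = (t : ℝ) ^ q := by
    rcases eq_or_ne (t : ℝ) 0 with h | h
    · rw [h, mul_zero, Real.zero_rpow (by linarith)]
    · rw [← Real.rpow_add_one h]; congr 1; ring
  have key : (t : ℝ) ^ q + q / (q - 1) * (s : ℝ) ^ (q - 1) * t ≤
      q / (q - 1) * (t : ℝ) ^ (q - 1) * t + (s : ℝ) ^ q := by
    rw [mul_assoc, mul_assoc, ht1]
    have := mul_le_mul_of_nonneg_left hy hK
    have e : q / (q - 1) * ((s : ℝ) ^ q / (q / (q - 1)) + (t : ℝ) ^ q / q) =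
       (s : ℝ) ^ q + (t : ℝ) ^ q * (1 / (q - 1)) := by
      have : q ≠ 0 := by linarith
      field_simp
    have e2 : q / (q - 1) = 1 + 1 / (q - 1) := by field_simp; ring
    rw [e] at this
    rw [e2] at this ⊢
    linarith
  have hq0 : 0 ≤ q := by linarith
  have := ENNReal.ofReal_le_ofReal key
  rw [ENNReal.ofReal_add (by positivity) (by positivity),
    ENNReal.ofReal_add (by positivity) (by positivity),
    ENNReal.ofReal_mul (by positivity), ENNReal.ofReal_mul (by positivity),
    ENNReal.ofReal_mul (by positivity), ENNReal.ofReal_mul (by positivity),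
    ← ENNReal.ofReal_rpow_of_nonneg (NNReal.coe_nonneg t) hq0, ← ENNReal.ofReal_rpow_of_nonneg (NNReal.coe_nonneg s) hq0,
    ← ENNReal.ofReal_rpow_of_nonneg (NNReal.coe_nonneg t) hq1.le, ← ENNReal.ofReal_rpow_of_nonneg (NNReal.coe_nonneg s) hq1.le,
    ENNReal.ofReal_coe_nnreal, ENNReal.ofReal_coe_nnreal] at this
  exact this

lemma young_aux2 (q : ℝ) (hq : 1 < q) (K s t : ℝ≥0∞) :
    K * s ^ (q - 1) * t ≤ K ^ q * t ^ q + s ^ q := by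
  have hq1 : 0 < q - 1 := by linarith
  have hself : ∀ u : ℝ≥0∞, u ^ (q - 1) * u = u ^ q := by
    intro u
    conv_lhs => rw [← ENNReal.rpow_one u]
    rw [← ENNReal.rpow_mul, one_mul,
      ← ENNReal.rpow_add_of_nonneg _ _ hq1.le zero_le_one]
    congr 1; ring
  rcases le_total (K * t) s with h | h
  · calc K * s ^ (q - 1) * t = s ^ (q - 1) * (K * t) := by ring
      _ ≤ s ^ (q - 1) * s := by gcongr
      _ = s ^ q := hself s
      _ ≤ _ := le_add_self
  · calc K * s ^ (q - 1) * t = s ^ (q - 1) * (K * t) := by ring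
      _ ≤ (K * t) ^ (q - 1) * (K * t) := by gcongr
      _ = K ^ q * t ^ q := by rw [hself, ENNReal.mul_rpow_of_nonneg _ _ (by linarith)]
      _ ≤ _ := le_self_add

/-- Dyadic Doob inequality by Bellman-type induction. -/
lemma doob_aux (q : ℝ) (hq : 1 < q) (F : (Fin n → ℝ) → ℝ≥0∞) (N : ℕ) (k : ℤ) (mv : Fin n → ℤ)
    (s : ℝ≥0∞) (hs : s ≠ ∞) (hF : ∫⁻ x in dyadicCube k mv, F x ≠ ∞) :
    (∫⁻ x in dyadicCube k mv, (s ⊔ smax (avg F) N k x) ^ q) +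
      2 * ENNReal.ofReal (q / (q - 1)) * s ^ (q - 1) * ∫⁻ x in dyadicCube k mv, F x ≤
    (2 * ENNReal.ofReal (q / (q - 1))) ^ q * (∫⁻ x in dyadicCube k mv, F x ^ q) +
      2 * s ^ q * volume (dyadicCube k mv) := by
  set K := ENNReal.ofReal (q / (q - 1)) with hKdef
  have hKt : K ≠ ∞ := ENNReal.ofReal_ne_top
  have hq0 : 0 ≤ q := by linarith
  have hq1 : 0 ≤ q - 1 := by linarith
  induction N generalizing k mv s with
  | zero =>
    have h2 : 2 * K * s ^ (q - 1) * (∫⁻ x in dyadicCube k mv, F x) ≤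
        (2 * K) ^ q * (∫⁻ x in dyadicCube k mv, F x ^ q) + s ^ q * volume (dyadicCube k mv) := by
      calc _ ≤ ∫⁻ x in dyadicCube k mv, 2 * K * s ^ (q - 1) * F x := lintegral_const_mul_le _ _
        _ ≤ ∫⁻ x in dyadicCube k mv, ((2 * K) ^ q * F x ^ q + s ^ q) :=
            lintegral_mono fun x => young_aux2 q hq _ _ _
        _ = _ := by
          rw [lintegral_add_right _ measurable_const, setLIntegral_const, lintegral_const_mul']
          exact ENNReal.rpow_ne_top_of_nonneg hq0 (ENNReal.mul_ne_top (by simp) hKt)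
    have h1 : (∫⁻ x in dyadicCube k mv, (s ⊔ smax (avg F) 0 k x) ^ q) =
        s ^ q * volume (dyadicCube k mv) := by
      simp [smax]
    rw [h1]
    calc _ ≤ _ := add_le_add le_rfl h2
      _ = _ := by ring
  | succ N ih =>
    set T := ∫⁻ x in dyadicCube k mv, F x with hT
    set V := volume (dyadicCube k mv) with hV
    set A := avg F k mv with hA
    have hAT : A * V = T := ENNReal.div_mul_cancel (vol_ne_zero k mv) (vol_ne_top k mv)
    have hAt : A ≠ ∞ := ENNReal.div_ne_top hF (vol_ne_zero k mv)
    set s' := s ⊔ A with hs'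
    have hsT : s' ≠ ∞ := by
      rcases le_total s A with h | h
      · rw [hs', sup_eq_right.2 h]; exact hAt
      · rw [hs', sup_eq_left.2 h]; exact hs
    have hch : (∫⁻ x in dyadicCube k mv, (s' ⊔ smax (avg F) N (k + 1) x) ^ q) +
        2 * K * s' ^ (q - 1) * T ≤
        (2 * K) ^ q * (∫⁻ x in dyadicCube k mv, F x ^ q) + 2 * s' ^ q * V := by
      have hV1 : V = ∫⁻ x in dyadicCube k mv, 1 := by simp [hV]
      rw [hV1, hT]
      simp only [lintegral_children (n := n) volume _ k mv]
      rw [← ENNReal.tsum_mul_left, ← ENNReal.tsum_mul_left, ← ENNReal.tsum_mul_left,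
        ← ENNReal.tsum_add, ← ENNReal.tsum_add]
      refine ENNReal.tsum_le_tsum fun j => ?_
      have := ih (k + 1) j.1 s' hsT ?_
      · simpa using this
      · refine ne_top_of_le_ne_top hF ?_
        rw [hT, lintegral_children (n := n) volume _ k mv]
        exact ENNReal.le_tsum j
    have hM : (∫⁻ x in dyadicCube k mv, (s ⊔ smax (avg F) (N + 1) k x) ^ q) =
        ∫⁻ x in dyadicCube k mv, (s' ⊔ smax (avg F) N (k + 1) x) ^ q := by
      refine setLIntegral_congr_fun (measurableSet_dy _ _) fun x hx => ?_
      rw [mem_dyadicCube_iff] at hx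
      have e : smax (avg F) (N + 1) k x = A ⊔ smax (avg F) N (k + 1) x := by
        rw [hA, ← hx]; rfl
      simp only [e, hs', sup_assoc]
    have hy : s' ^ q * V + K * s ^ (q - 1) * T ≤ K * s' ^ (q - 1) * T + s ^ q * V := by
      rcases le_total s A with h | h
      · have : s' = A := sup_eq_right.2 h
        rw [this, ← hAT]
        calc _ = (A ^ q + K * s ^ (q - 1) * A) * V := by ring
          _ ≤ (K * A ^ (q - 1) * A + s ^ q) * V := mul_le_mul_left (young_aux q hq s A hs hAt) V
          _ = _ := by ring
      · have : s' = s := sup_eq_left.2 h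
        rw [this, add_comm]
    rw [hM]
    have hfin : 2 * K * s' ^ (q - 1) * T + 2 * s' ^ q * V ≠ ∞ := by
      refine ENNReal.add_ne_top.2 ⟨?_, ?_⟩
      · exact ENNReal.mul_ne_top (ENNReal.mul_ne_top (ENNReal.mul_ne_top (by simp) hKt)
          (ENNReal.rpow_ne_top_of_nonneg hq1 hsT)) hF
      · exact ENNReal.mul_ne_top (ENNReal.mul_ne_top (by simp)
          (ENNReal.rpow_ne_top_of_nonneg hq0 hsT)) (vol_ne_top k mv)
    rw [← ENNReal.add_le_add_iff_right hfin]
    calc _ = ((∫⁻ x in dyadicCube k mv, (s' ⊔ smax (avg F) N (k + 1) x) ^ q) +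
          2 * K * s' ^ (q - 1) * T) + 2 * (s' ^ q * V + K * s ^ (q - 1) * T) := by ring
      _ ≤ ((2 * K) ^ q * (∫⁻ x in dyadicCube k mv, F x ^ q) + 2 * s' ^ q * V) +
          2 * (K * s' ^ (q - 1) * T + s ^ q * V) := by gcongr
      _ = _ := by ring

lemma doob (q : ℝ) (hq : 1 < q) (F : (Fin n → ℝ) → ℝ≥0∞) (N : ℕ) (k : ℤ) (mv : Fin n → ℤ) :
    (∫⁻ x in dyadicCube k mv, (smax (avg F) N k x) ^ q) ≤
    (2 * ENNReal.ofReal (q / (q - 1))) ^ q * (∫⁻ x in dyadicCube k mv, F x ^ q) := by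
  have hq1 : 0 < q - 1 := by linarith
  by_cases h : (∫⁻ x in dyadicCube k mv, F x ^ q) = ∞
  · rw [h, ENNReal.mul_top]
    · exact le_top
    · have : ENNReal.ofReal (q / (q - 1)) ≠ 0 := by
        rw [Ne, ENNReal.ofReal_eq_zero, not_le]; positivity
      simp [this, ENNReal.rpow_eq_zero_iff]
      intro _; linarith
  · have hF : ∫⁻ x in dyadicCube k mv, F x ≠ ∞ := by
      refine ne_top_of_le_ne_top (b := (∫⁻ x in dyadicCube k mv, F x ^ q) + volume (dyadicCube k mv))
        (ENNReal.add_ne_top.2 ⟨h, vol_ne_top k mv⟩) ?_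
      calc _ ≤ ∫⁻ x in dyadicCube k mv, (F x ^ q + 1) := by
            refine lintegral_mono fun x => ?_
            rcases le_total (F x) 1 with h | h
            · exact h.trans le_add_self
            · refine le_trans ?_ le_self_add
              exact ENNReal.le_rpow_self_of_one_le h hq.le
        _ = _ := by rw [lintegral_add_right _ measurable_const]; simp
    have := doob_aux q hq F N k mv 0 (by simp) hF
    simpa [ENNReal.zero_rpow_of_pos hq1, ENNReal.zero_rpow_of_pos (zero_lt_one.trans hq)] using this


lemma dyadic_le_growth (μ : Measure (Fin n → ℝ)) (β : ℝ) (k : ℤ) (mv : Fin n → ℤ) :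
    μ (dyadicCube k mv) ≤ measureGrowthNorm μ β * ENNReal.ofReal ((2 : ℝ) ^ (-k)) ^ β := by
  have h : μ (dyadicCube k mv) / ENNReal.ofReal ((2 : ℝ) ^ (-k)) ^ β ≤ measureGrowthNorm μ β := by
    unfold measureGrowthNorm dyadicCube
    exact le_iSup_of_le _ (le_iSup_of_le _ (le_iSup_of_le (by positivity) le_rfl))
  refine (ENNReal.div_le_iff ?_ ?_).1 h
  · exact (ENNReal.rpow_pos (pos_iff_ne_zero.2 (L_ne_zero k)) ENNReal.ofReal_ne_top).ne'
  · exact ENNReal.rpow_ne_top_of_ne_zero (L_ne_zero k) ENNReal.ofReal_ne_top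

lemma L_anti (k l : ℤ) (h : k ≤ l) :
    ENNReal.ofReal ((2 : ℝ) ^ (-l)) ≤ ENNReal.ofReal ((2 : ℝ) ^ (-k)) :=
  ENNReal.ofReal_le_ofReal (zpow_le_zpow_right₀ (by norm_num) (by omega))

def cf {m : ℕ} (α : ℝ) (F : Fin m → (Fin n → ℝ) → ℝ≥0∞) (k : ℤ) (mv : Fin n → ℤ) : ℝ≥0∞ :=
  ENNReal.ofReal ((2 : ℝ) ^ (-k)) ^ (α - (m : ℝ) * n) * ∏ j, ∫⁻ y in dyadicCube k mv, F j y

lemma cf_eq {m : ℕ} (α : ℝ) (F : Fin m → (Fin n → ℝ) → ℝ≥0∞) (k : ℤ) (mv : Fin n → ℤ) :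
    cf α F k mv = ENNReal.ofReal ((2 : ℝ) ^ (-k)) ^ α * ∏ j, avg (F j) k mv := by
  have h : ∀ j, ∫⁻ y in dyadicCube k mv, F j y =
      avg (F j) k mv * ENNReal.ofReal ((2 : ℝ) ^ (-k)) ^ (n : ℝ) := by
    intro j
    rw [ENNReal.rpow_natCast, ← vol_dy k mv]
    exact (ENNReal.div_mul_cancel (vol_ne_zero k mv) (vol_ne_top k mv)).symm
  unfold cf
  simp only [h]
  rw [Finset.prod_mul_distrib, Finset.prod_const, Finset.card_univ, Fintype.card_fin,
    ← ENNReal.rpow_natCast, ← ENNReal.rpow_mul]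
  have e : α = (α - (m : ℝ) * n) + n * m := by ring
  conv_rhs => rw [e, ENNReal.rpow_add _ _ (L_ne_zero k) ENNReal.ofReal_ne_top]
  ring

def DD {m : ℕ} (P : Fin m → ℝ) : ℝ≥0∞ := ∏ j, (2 * ENNReal.ofReal (P j / (P j - 1)))

lemma local_bound {m : ℕ} (P : Fin m → ℝ) (hP : ∀ j, 1 < P j) (p α : ℝ)
    (hp : 1 / p = ∑ j, 1 / P j) (hp0 : 0 < p) (hα : 0 < α) (μ : Measure (Fin n → ℝ))
    (F : Fin m → (Fin n → ℝ) → ℝ≥0∞) (k : ℤ) (mv : Fin n → ℤ) :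
    ∫⁻ x in dyadicCube k mv, (⨆ N, smax (cf α F) N k x) ^ p ∂μ ≤
      measureGrowthNorm μ (n - α * p) *
        (DD P * ∏ j, (∫⁻ x in dyadicCube k mv, F j x ^ P j) ^ (1 / P j)) ^ p := by
  have h1 : ∀ x, (⨆ N, smax (cf α F) N k x) ^ p = ⨆ N, (smax (cf α F) N k x) ^ p := by
    intro x
    exact (ENNReal.orderIsoRpow p hp0).map_iSup _
  simp only [h1]
  rw [lintegral_iSup]
  rotate_left
  · intro N
    exact (measurable_smax _ N k).pow_const p
  · refine monotone_nat_of_le_succ fun N x => ?_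
    exact ENNReal.rpow_le_rpow (smax_mono _ N k x) hp0.le
  refine iSup_le fun N => ?_
  set w : ℤ → ℝ≥0∞ := fun k => ENNReal.ofReal ((2 : ℝ) ^ (-k)) ^ (α * p) with hw
  set d : ℤ → (Fin n → ℤ) → ℝ≥0∞ := fun k i => ∏ j, (avg (F j) k i) ^ p with hd
  have h2 : ∀ x, (smax (cf α F) N k x) ^ p ≤ smax (fun k i => w k * (d k i - 0)) N k x := by
    intro x
    rw [← ENNReal.le_rpow_inv_iff hp0]
    refine smax_le _ _ _ _ _ fun i hi => ?_
    rw [ENNReal.le_rpow_inv_iff hp0]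
    refine le_trans (le_of_eq ?_) (le_smax' _ N k x i hi)
    simp only [hw, hd, tsub_zero]
    rw [cf_eq, ENNReal.mul_rpow_of_nonneg _ _ hp0.le, ← ENNReal.rpow_mul,
      ENNReal.prod_rpow_of_nonneg hp0.le]
  have hwa : Antitone w := by
    intro k l h
    exact ENNReal.rpow_le_rpow (L_anti k l h) (by positivity)
  have hG : ∀ k mv, w k * μ (dyadicCube k mv) ≤
      measureGrowthNorm μ (n - α * p) * volume (dyadicCube k mv) := by
    intro k mv
    calc _ ≤ w k * (measureGrowthNorm μ (n - α * p) *
              ENNReal.ofReal ((2 : ℝ) ^ (-k)) ^ (n - α * p)) :=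
            mul_le_mul_right (dyadic_le_growth μ _ k mv) _
      _ = measureGrowthNorm μ (n - α * p) * (ENNReal.ofReal ((2 : ℝ) ^ (-k)) ^ (α * p) *
              ENNReal.ofReal ((2 : ℝ) ^ (-k)) ^ (n - α * p)) := by simp only [hw]; ring
      _ = _ := by
            rw [← ENNReal.rpow_add _ _ (L_ne_zero k) ENNReal.ofReal_ne_top, vol_dy,
              ← ENNReal.rpow_natCast]
            congr 2; ring
  have hPpos : ∀ j, 0 < P j := fun j => by linarith [hP j]
  have hsum : ∑ j, p / P j = 1 := by
    have : ∑ j, p / P j = p * ∑ j, 1 / P j := by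
      rw [Finset.mul_sum]; exact Finset.sum_congr rfl fun j _ => by ring
    rw [this, ← hp]; field_simp
  calc _ ≤ ∫⁻ x in dyadicCube k mv, smax (fun k i => w k * (d k i - 0)) N k x ∂μ :=
        lintegral_mono fun x => h2 x
    _ ≤ _ := carleson μ w hwa d _ hG N k mv 0
    _ ≤ measureGrowthNorm μ (n - α * p) * ∫⁻ x in dyadicCube k mv,
          ∏ j, (smax (avg (F j)) N k x ^ P j) ^ (p / P j) := by
        refine mul_le_mul_right (lintegral_mono fun x => ?_) _
        rw [tsub_zero]
        refine smax_le _ _ _ _ _ fun i hi => ?_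
        refine Finset.prod_le_prod' fun j _ => ?_
        rw [← ENNReal.rpow_mul, mul_div_cancel₀ _ (hPpos j).ne']
        exact ENNReal.rpow_le_rpow (le_smax' _ N k x i hi) hp0.le
    _ ≤ measureGrowthNorm μ (n - α * p) * ∏ j, (∫⁻ x in dyadicCube k mv,
          smax (avg (F j)) N k x ^ P j) ^ (p / P j) := by
        refine mul_le_mul_right ?_ _
        refine ENNReal.lintegral_prod_norm_pow_le (Finset.univ) (fun j _ => ?_) hsum
          (fun j _ => (div_pos hp0 (hPpos j)).le)
        exact ((measurable_smax _ N k).pow_const _).aemeasurable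
    _ ≤ measureGrowthNorm μ (n - α * p) * ∏ j,
          ((2 * ENNReal.ofReal (P j / (P j - 1))) ^ P j *
            (∫⁻ x in dyadicCube k mv, F j x ^ P j)) ^ (p / P j) := by
        refine mul_le_mul_right (Finset.prod_le_prod' fun j _ => ?_) _
        exact ENNReal.rpow_le_rpow (doob _ (hP j) _ N k mv) (div_pos hp0 (hPpos j)).le
    _ = _ := by
        congr 1
        rw [DD, ← Finset.prod_mul_distrib, ← ENNReal.prod_rpow_of_nonneg hp0.le]
        refine Finset.prod_congr rfl fun j _ => ?_
        rw [ENNReal.mul_rpow_of_nonneg _ _ (div_pos hp0 (hPpos j)).le,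
          ENNReal.mul_rpow_of_nonneg _ _ hp0.le, ← ENNReal.rpow_mul, ← ENNReal.rpow_mul]
        congr 2
        · rw [mul_div_cancel₀ _ (hPpos j).ne']
        · ring

lemma prod_le_norm {m : ℕ} (P : Fin m → ℝ) (p p0 : ℝ) (f : Fin m → (Fin n → ℝ) → ℝ)
    (k : ℤ) (mv : Fin n → ℤ) :
    ∏ j, (∫⁻ x in dyadicCube k mv, ENNReal.ofReal |f j x| ^ P j) ^ (1 / P j) ≤
      ENNReal.ofReal ((2 : ℝ) ^ (-k)) ^ (n / p - n / p0) * prodMorreyNorm P p p0 f := by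
  have h : volume (dyadicCube k mv) ^ (1 / p0 - 1 / p) *
      ∏ j, (∫⁻ x in dyadicCube k mv, ENNReal.ofReal |f j x| ^ P j) ^ (1 / P j) ≤
        prodMorreyNorm P p p0 f := by
    unfold prodMorreyNorm dyadicCube
    exact le_iSup_of_le _ (le_iSup_of_le _ (le_iSup_of_le (by positivity) le_rfl))
  rw [vol_dy, ← ENNReal.rpow_natCast, ← ENNReal.rpow_mul] at h
  refine le_trans (le_of_eq ?_) (mul_le_mul_right h _)
  rw [← mul_assoc, ← ENNReal.rpow_add _ _ (L_ne_zero k) ENNReal.ofReal_ne_top]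
  rw [show (n / p - n / p0 + n * (1 / p0 - 1 / p) : ℝ) = 0 by ring]
  simp

lemma cf_bound {m : ℕ} (P : Fin m → ℝ) (hP : ∀ j, 1 < P j) (p p0 α : ℝ)
    (hp : 1 / p = ∑ j, 1 / P j) (f : Fin m → (Fin n → ℝ) → ℝ)
    (k : ℤ) (mv : Fin n → ℤ) :
    cf α (fun j x => ENNReal.ofReal |f j x|) k mv ≤
      ENNReal.ofReal ((2 : ℝ) ^ (-k)) ^ (α - n / p0) * (DD P * prodMorreyNorm P p p0 f) := by
  have hPpos : ∀ j, 0 < P j := fun j => by linarith [hP j]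
  set L := ENNReal.ofReal ((2 : ℝ) ^ (-k)) with hL
  have hL0 : L ≠ 0 := L_ne_zero k
  have hLt : L ≠ ∞ := ENNReal.ofReal_ne_top
  have ha : ∀ j, avg (fun x => ENNReal.ofReal |f j x|) k mv ≤
      L ^ (-(n : ℝ) * (1 / P j)) * ((2 * ENNReal.ofReal (P j / (P j - 1))) *
        (∫⁻ x in dyadicCube k mv, ENNReal.ofReal |f j x| ^ P j) ^ (1 / P j)) := by
    intro j
    have h := doob (P j) (hP j) (fun x => ENNReal.ofReal |f j x|) 1 k mv
    have e : (∫⁻ x in dyadicCube k mv, (smax (avg fun x => ENNReal.ofReal |f j x|) 1 k x) ^ P j) =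
        avg (fun x => ENNReal.ofReal |f j x|) k mv ^ P j * L ^ (n : ℝ) := by
      rw [ENNReal.rpow_natCast, hL, ← vol_dy k mv, ← setLIntegral_const]
      refine setLIntegral_congr_fun (measurableSet_dy _ _) fun x hx => ?_
      rw [mem_dyadicCube_iff] at hx
      simp [smax, hx]
    rw [e] at h
    have h' := ENNReal.rpow_le_rpow h (one_div_pos.2 (hPpos j)).le
    rw [ENNReal.mul_rpow_of_nonneg _ _ (one_div_pos.2 (hPpos j)).le,
      ENNReal.mul_rpow_of_nonneg _ _ (one_div_pos.2 (hPpos j)).le, ← ENNReal.rpow_mul,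
      ← ENNReal.rpow_mul, ← ENNReal.rpow_mul, mul_one_div_cancel (hPpos j).ne',
      ENNReal.rpow_one, ENNReal.rpow_one] at h'
    refine le_trans (le_of_eq ?_) (mul_le_mul_right h' _)
    rw [mul_comm, mul_assoc, ← ENNReal.rpow_add _ _ hL0 hLt]
    rw [show (n * (1 / P j) + -(n : ℝ) * (1 / P j) : ℝ) = 0 by ring]
    simp
  rw [cf_eq]
  calc _ ≤ L ^ α * ∏ j, (L ^ (-(n : ℝ) * (1 / P j)) * ((2 * ENNReal.ofReal (P j / (P j - 1))) *
        (∫⁻ x in dyadicCube k mv, ENNReal.ofReal |f j x| ^ P j) ^ (1 / P j))) :=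
        mul_le_mul_right (Finset.prod_le_prod' fun j _ => ha j) _
    _ = L ^ α * (L ^ (-(n : ℝ) * (1 / p)) * (DD P *
          ∏ j, (∫⁻ x in dyadicCube k mv, ENNReal.ofReal |f j x| ^ P j) ^ (1 / P j))) := by
        rw [Finset.prod_mul_distrib, Finset.prod_mul_distrib, ← DD, hp, Finset.mul_sum]
        congr 2
        induction (Finset.univ : Finset (Fin m)) using Finset.induction_on with
        | empty => simp
        | insert a s ha ih =>
          rw [Finset.prod_insert ha, Finset.sum_insert ha, ENNReal.rpow_add _ _ hL0 hLt, ih]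
    _ ≤ L ^ α * (L ^ (-(n : ℝ) * (1 / p)) * (DD P *
          (L ^ (n / p - n / p0) * prodMorreyNorm P p p0 f))) := by
        gcongr
        exact prod_le_norm P p p0 f k mv
    _ = (L ^ α * L ^ (-(n : ℝ) * (1 / p)) * L ^ (n / p - n / p0)) *
          (DD P * prodMorreyNorm P p p0 f) := by ring
    _ = _ := by
        rw [← ENNReal.rpow_add _ _ hL0 hLt, ← ENNReal.rpow_add _ _ hL0 hLt]
        congr 2; ring

lemma dymax_le {m : ℕ} (P : Fin m → ℝ) (hP : ∀ j, 1 < P j) (p p0 α : ℝ)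
    (hp : 1 / p = ∑ j, 1 / P j) (hα0 : α - n / p0 ≤ 0)
    (f : Fin m → (Fin n → ℝ) → ℝ) (k : ℤ) (x : Fin n → ℝ) :
    dyadicFracMaximal α f x ≤
      (ENNReal.ofReal ((2 : ℝ) ^ (-k)) ^ (α - n / p0) * (DD P * prodMorreyNorm P p p0 f)) ⊔
      ⨆ N, smax (cf α (fun j x => ENNReal.ofReal |f j x|)) N k x := by
  unfold dyadicFracMaximal
  refine iSup_le fun l => iSup_le fun mv => iSup_le fun hx => ?_
  change cf α (fun j x => ENNReal.ofReal |f j x|) l mv ≤ _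
  rcases le_total l k with h | h
  · refine le_trans ((cf_bound P hP p p0 α hp f l mv).trans ?_) le_sup_left
    refine mul_le_mul_left ?_ _
    rw [show α - n / p0 = -(n / p0 - α) by ring, ENNReal.rpow_neg, ENNReal.rpow_neg,
      ENNReal.inv_le_inv]
    exact ENNReal.rpow_le_rpow (L_anti l k h) (by linarith)
  · refine le_trans ?_ le_sup_right
    rw [mem_dyadicCube_iff] at hx
    obtain ⟨i, rfl⟩ := Int.le.dest h
    rw [← hx]
    exact le_iSup_of_le (i + 1) (le_smax _ i k x)

lemma dyadic_bound {m : ℕ} (P : Fin m → ℝ) (hP : ∀ j, 1 < P j) (p p0 α : ℝ)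
    (hp : 1 / p = ∑ j, 1 / P j) (hp0 : 0 < p) (hα : 0 < α) (hα0 : α - n / p0 ≤ 0)
    (μ : Measure (Fin n → ℝ))
    (f : Fin m → (Fin n → ℝ) → ℝ) (k : ℤ) (mv : Fin n → ℤ) :
    ∫⁻ x in dyadicCube k mv, dyadicFracMaximal α f x ^ p ∂μ ≤
      2 * (measureGrowthNorm μ (n - α * p) *
        (DD P * (ENNReal.ofReal ((2 : ℝ) ^ (-k)) ^ (n / p - n / p0) *
          prodMorreyNorm P p p0 f)) ^ p) := by
  set G := measureGrowthNorm μ (n - α * p)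
  set Nr := prodMorreyNorm P p p0 f
  set L := ENNReal.ofReal ((2 : ℝ) ^ (-k)) with hL
  have hL0 : L ≠ 0 := L_ne_zero k
  have hLt : L ≠ ∞ := ENNReal.ofReal_ne_top
  set F : Fin m → (Fin n → ℝ) → ℝ≥0∞ := fun j x => ENNReal.ofReal |f j x| with hF
  have h1 : ∀ x, dyadicFracMaximal α f x ^ p ≤
      (L ^ (α - n / p0) * (DD P * Nr)) ^ p + (⨆ N, smax (cf α F) N k x) ^ p := by
    intro x
    refine (ENNReal.rpow_le_rpow (dymax_le P hP p p0 α hp hα0 f k x) hp0.le).trans ?_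
    rcases le_total (L ^ (α - n / p0) * (DD P * Nr)) (⨆ N, smax (cf α F) N k x) with h | h
    · rw [sup_eq_right.2 h]; exact le_add_self
    · rw [sup_eq_left.2 h]; exact le_self_add
  calc _ ≤ ∫⁻ x in dyadicCube k mv, ((L ^ (α - n / p0) * (DD P * Nr)) ^ p +
            (⨆ N, smax (cf α F) N k x) ^ p) ∂μ := lintegral_mono fun x => h1 x
    _ = (L ^ (α - n / p0) * (DD P * Nr)) ^ p * μ (dyadicCube k mv) +
          ∫⁻ x in dyadicCube k mv, (⨆ N, smax (cf α F) N k x) ^ p ∂μ := by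
        rw [lintegral_add_left measurable_const, setLIntegral_const]
    _ ≤ (L ^ (α - n / p0) * (DD P * Nr)) ^ p * (G * L ^ (n - α * p)) +
          G * (DD P * (L ^ (n / p - n / p0) * Nr)) ^ p := by
        refine add_le_add (mul_le_mul_right (dyadic_le_growth μ _ k mv) _) ?_
        refine (local_bound P hP p α hp hp0 hα μ F k mv).trans ?_
        refine mul_le_mul_right (ENNReal.rpow_le_rpow (mul_le_mul_right ?_ _) hp0.le) _
        exact prod_le_norm P p p0 f k mv
    _ = _ := by
        rw [two_mul]
        congr 1
        have e1 : (L ^ (α - n / p0) * (DD P * Nr)) ^ p =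
            L ^ ((α - n / p0) * p) * (DD P * Nr) ^ p := by
          rw [ENNReal.mul_rpow_of_nonneg _ _ hp0.le, ← ENNReal.rpow_mul]
        have e2 : (DD P * (L ^ (n / p - n / p0) * Nr)) ^ p =
            L ^ ((n / p - n / p0) * p) * (DD P * Nr) ^ p := by
          rw [show DD P * (L ^ (n / p - n / p0) * Nr) = L ^ (n / p - n / p0) * (DD P * Nr) by ring,
            ENNReal.mul_rpow_of_nonneg _ _ hp0.le, ← ENNReal.rpow_mul]
        rw [e1, e2, show ((n / p - n / p0) * p : ℝ) = (α - n / p0) * p + (n - α * p) by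
          field_simp; ring, ENNReal.rpow_add _ _ hL0 hLt]
        ring

lemma cube_cover (a : Fin n → ℝ) (r : ℝ) (k : ℤ) (hr : r ≤ (2 : ℝ) ^ (-k)) :
    cube a r ⊆ ⋃ e : Fin n → Fin 2, dyadicCube k (fun i => idx k a i + ((e i : ℕ) : ℤ)) := by
  intro x hx
  have h2 : (0 : ℝ) < (2 : ℝ) ^ k := by positivity
  have hr' : r * (2 : ℝ) ^ k ≤ 1 := by
    rw [zpow_neg] at hr
    calc r * (2 : ℝ) ^ k ≤ ((2 : ℝ) ^ k)⁻¹ * 2 ^ k := by gcongr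
      _ = 1 := inv_mul_cancel₀ h2.ne'
  have h : ∀ i, ∃ e : Fin 2, idx k x i = idx k a i + ((e : ℕ) : ℤ) := by
    intro i
    obtain ⟨ha, hb⟩ := hx i
    have h3 : idx k a i ≤ idx k x i := Int.floor_le_floor (by gcongr)
    have h4 : idx k x i < idx k a i + 2 := by
      unfold idx
      rw [Int.floor_lt]
      push_cast
      have h5 := Int.lt_floor_add_one (a i * (2 : ℝ) ^ k)
      have h6 : x i * (2 : ℝ) ^ k < (a i + r) * (2 : ℝ) ^ k := by gcongr
      rw [add_mul] at h6
      linarith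
    rcases (show idx k x i = idx k a i ∨ idx k x i = idx k a i + 1 by omega) with h | h
    · exact ⟨0, by simp [h]⟩
    · exact ⟨1, by simp [h]⟩
  choose e he using h
  refine Set.mem_iUnion.2 ⟨e, ?_⟩
  rw [mem_dyadicCube_iff]
  exact funext he

theorem statement5 (hn : 0 < n) (m : ℕ) (hm : 0 < m)
    (P : Fin m → ℝ) (hP : ∀ j, 1 < P j) (p p0 α : ℝ)
    (hp : 1 / p = ∑ j, 1 / P j) (hp0 : 0 < p) (hpp0 : p ≤ p0)
    (hp0n : p0 < n / α) (hα : 0 < α) (hαmn : α < (m : ℝ) * n) :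
    ∃ C : ℝ≥0∞, 0 < C ∧ C < ∞ ∧
      ∀ μ : Measure (Fin n → ℝ), IsLocallyFiniteMeasure μ →
        ∀ f : Fin m → (Fin n → ℝ) → ℝ,
          radonMorreyNorm μ p p0 (dyadicFracMaximal α f) ≤
            C * measureGrowthNorm μ (n - α * p) ^ (1 / p) *
              prodMorreyNorm P p p0 f := by
  have hp0' : 0 < p0 := lt_of_lt_of_le hp0 hpp0
  have hα0 : α - n / p0 ≤ 0 := by
    rw [sub_nonpos, le_div_iff₀ hp0', mul_comm]
    exact ((lt_div_iff₀ hα).1 hp0n).le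
  set γ : ℝ := n / p - n / p0 with hγ
  have hγ0 : 0 ≤ γ := sub_nonneg.2 (div_le_div_of_nonneg_left (by positivity) hp0 hpp0)
  have hD0 : DD P ≠ 0 := by
    unfold DD
    refine Finset.prod_ne_zero_iff.2 fun j _ => mul_ne_zero (by simp) ?_
    rw [Ne, ENNReal.ofReal_eq_zero, not_le]
    have := hP j
    exact div_pos (by linarith) (by linarith)
  have hDt : DD P ≠ ∞ := by
    unfold DD
    exact ENNReal.prod_ne_top fun j _ => ENNReal.mul_ne_top (by simp) ENNReal.ofReal_ne_top
  have h2n0 : ((2 : ℝ≥0∞) ^ n * 2) ≠ 0 := by simp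
  have h2nt : ((2 : ℝ≥0∞) ^ n * 2) ≠ ∞ := ENNReal.mul_ne_top (by simp) (by simp)
  refine ⟨((2 : ℝ≥0∞) ^ n * 2) ^ (1 / p) * DD P * 2 ^ γ, ?_, ?_, ?_⟩
  · refine pos_iff_ne_zero.2 (mul_ne_zero (mul_ne_zero ?_ hD0) ?_)
    · exact (ENNReal.rpow_pos (pos_iff_ne_zero.2 h2n0) h2nt).ne'
    · exact (ENNReal.rpow_pos (by simp) (by simp)).ne'
  · refine lt_top_iff_ne_top.2 (ENNReal.mul_ne_top (ENNReal.mul_ne_top ?_ hDt) ?_)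
    · exact ENNReal.rpow_ne_top_of_nonneg (by positivity) h2nt
    · exact ENNReal.rpow_ne_top_of_nonneg hγ0 (by simp)
  intro μ _ f
  set G := measureGrowthNorm μ (n - α * p) with hG
  set Nr := prodMorreyNorm P p p0 f with hNr
  refine iSup_le fun a => iSup_le fun r => iSup_le fun hr => ?_
  obtain ⟨l, hl1, hl2⟩ := exists_mem_Ioc_zpow hr (by norm_num : (1 : ℝ) < 2)
  obtain ⟨k, rfl⟩ : ∃ k : ℤ, l = -k - 1 := ⟨-l - 1, by ring⟩
  rw [sub_add_cancel] at hl2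
  set L := ENNReal.ofReal ((2 : ℝ) ^ (-k)) with hL
  set R := ENNReal.ofReal r with hR
  have hR0 : R ≠ 0 := by rw [hR, Ne, ENNReal.ofReal_eq_zero, not_le]; exact hr
  have hRt : R ≠ ∞ := ENNReal.ofReal_ne_top
  have hLR : L ≤ 2 * R := by
    rw [hL, hR, ← ENNReal.ofReal_ofNat 2, ← ENNReal.ofReal_mul (by norm_num)]
    refine ENNReal.ofReal_le_ofReal ?_
    rw [zpow_sub_one₀ (by norm_num)] at hl1
    linarith
  have hInt : ∫⁻ x in cube a r, dyadicFracMaximal α f x ^ p ∂μ ≤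
      (2 ^ n * 2) * (G * (DD P * (L ^ γ * Nr)) ^ p) := by
    calc _ ≤ ∫⁻ x in ⋃ e : Fin n → Fin 2, dyadicCube k (fun i => idx k a i + ((e i : ℕ) : ℤ)),
            dyadicFracMaximal α f x ^ p ∂μ := lintegral_mono_set (cube_cover a r k hl2)
      _ ≤ ∑' e : Fin n → Fin 2, ∫⁻ x in dyadicCube k (fun i => idx k a i + ((e i : ℕ) : ℤ)),
            dyadicFracMaximal α f x ^ p ∂μ := lintegral_iUnion_le _ _
      _ ≤ ∑' e : Fin n → Fin 2, 2 * (G * (DD P * (L ^ γ * Nr)) ^ p) :=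
            ENNReal.tsum_le_tsum fun e =>
              dyadic_bound P hP p p0 α hp hp0 hα hα0 μ f k _
      _ = _ := by
            rw [tsum_fintype, Finset.sum_const, Finset.card_univ]
            simp [mul_assoc]
  have hp1 : 0 ≤ 1 / p := by positivity
  calc _ ≤ volume (cube a r) ^ (1 / p0 - 1 / p) *
          ((2 ^ n * 2) * (G * (DD P * ((2 * R) ^ γ * Nr)) ^ p)) ^ (1 / p) := by
        refine mul_le_mul_right (ENNReal.rpow_le_rpow (hInt.trans ?_) hp1) _
        gcongr
    _ = R ^ (-γ) * ((2 ^ n * 2) ^ (1 / p) * (G ^ (1 / p) * (DD P * ((2 ^ γ * R ^ γ) * Nr)))) := by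
        rw [volume_cube, ← ENNReal.rpow_natCast, ← ENNReal.rpow_mul,
          ENNReal.mul_rpow_of_nonneg (2 ^ n * 2) _ hp1, ENNReal.mul_rpow_of_nonneg G _ hp1,
          ← ENNReal.rpow_mul (DD P * ((2 * R) ^ γ * Nr)), mul_one_div_cancel hp0.ne',
          ENNReal.rpow_one, ENNReal.mul_rpow_of_nonneg _ _ hγ0]
        congr 2
        rw [hγ]; ring
    _ = (R ^ (-γ) * R ^ γ) * (((2 : ℝ≥0∞) ^ n * 2) ^ (1 / p) * DD P * 2 ^ γ * G ^ (1 / p) * Nr) := by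
        ring
    _ = _ := by
        rw [← ENNReal.rpow_add _ _ hR0 hRt, neg_add_cancel, ENNReal.rpow_zero, one_mul]
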